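/- Let G = (V, E_G, w^G, μ) be a weighted submodular hypergraph whose cut functions δ_h are monotone submodular cut functions induced by non-decreasing submodular functions F_h, and let H = (V, E_H, w^H) be a weighted graph. If H embeds into G as a flow with congestion ρ (H ≼_ρ G), then for every x ∈ ℝ^V: ∑_{{i,j}∈E_H} w^H_{ij} |x_i − x_j| ≤ ρ · ∑_{h∈E_G} w^G_h · min_{u∈ℝ} ‖x_h − u·1‖_{F_h}, where x_h denotes the restriction of x to the coordinates in h. -/

import Mathlib

open Finset

/-- Membership in the symmetric submodular polyhedron `P_sym(F_h)` of the
non-decreasing submodular function `F` on subsets of the hyperedge `h`,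
for vectors of `ℝ^V` supported on `h`. -/
def memSymPolyOn {V : Type*} [Fintype V] [DecidableEq V]
    (h : Finset V) (F : Finset V → ℝ) (y : V → ℝ) : Prop :=
  (∀ i, i ∉ h → y i = 0) ∧ ∀ S ⊆ h, (∑ i ∈ S, |y i|) ≤ F S

/-- The norm `‖x‖_{F_h} = max_{y ∈ P_sym(F_h)} ⟨y, x⟩` on `ℝ^h`. -/
noncomputable def normFOn {V : Type*} [Fintype V] [DecidableEq V]
    (h : Finset V) (F : Finset V → ℝ) (x : V → ℝ) : ℝ :=
  sSup {r | ∃ y : V → ℝ, memSymPolyOn h F y ∧ r = ∑ i, y i * x i}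

/-- The dual norm `‖z‖_{*,F_h} = min {λ ≥ 0 : z ∈ λ·P_sym(F_h)}`. -/
noncomputable def dualNormFOn {V : Type*} [Fintype V] [DecidableEq V]
    (h : Finset V) (F : Finset V → ℝ) (z : V → ℝ) : ℝ :=
  sInf {l : ℝ | 0 ≤ l ∧ ∀ S ⊆ h, (∑ i ∈ S, |z i|) ≤ l * F S}

lemma norm_bdd {V : Type*} [Fintype V] [DecidableEq V]
    (h : Finset V) (F : Finset V → ℝ) (x : V → ℝ) :
    BddAbove {r | ∃ y : V → ℝ, memSymPolyOn h F y ∧ r = ∑ i, y i * x i} := by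
  refine ⟨∑ i, |F {i}| * |x i|, ?_⟩
  rintro r ⟨y, ⟨hy0, hy⟩, rfl⟩
  refine Finset.sum_le_sum fun i _ => ?_
  refine (le_abs_self _).trans ?_
  rw [abs_mul]
  refine mul_le_mul_of_nonneg_right ?_ (abs_nonneg _)
  by_cases hi : i ∈ h
  · have := hy {i} (by simpa using hi)
    rw [Finset.sum_singleton] at this
    exact this.trans (le_abs_self _)
  · rw [hy0 i hi]; simp

lemma holder_aux {V : Type*} [Fintype V] [DecidableEq V]
    (h : Finset V) (F : Finset V → ℝ) (x z : V → ℝ)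
    (hF : ∀ S ⊆ h, 0 ≤ F S) (hz : ∀ i, 0 ≤ z i) (hz0 : ∀ i, i ∉ h → z i = 0)
    (l : ℝ) (hl : 0 ≤ l) (hS : ∀ S ⊆ h, (∑ i ∈ S, |z i|) ≤ l * F S) :
    ∑ i, z i * |x i| ≤ l * normFOn h F x := by
  rcases hl.eq_or_lt with rfl | hl
  · have : ∀ i, z i = 0 := by
      intro i
      by_cases hi : i ∈ h
      · have := hS {i} (by simpa using hi)
        rw [Finset.sum_singleton, zero_mul] at this
        exact abs_nonpos_iff.mp this
      · exact hz0 i hi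
    simp [this]
  · rw [← div_le_iff₀' hl]
    refine le_csSup (norm_bdd h F x) ⟨fun i => z i / l * (if 0 ≤ x i then 1 else -1), ⟨?_, ?_⟩, ?_⟩
    · intro i hi
      simp [hz0 i hi]
    · intro S hSh
      have e : ∀ i, |z i / l * (if 0 ≤ x i then (1 : ℝ) else -1)| = |z i| / l := by
        intro i
        split_ifs <;> simp [abs_div, abs_of_pos hl]
      simp only [e]
      rw [← Finset.sum_div, div_le_iff₀' hl]
      exact hS S hSh
    · rw [Finset.sum_div]
      refine Finset.sum_congr rfl fun i _ => ?_
      dsimp only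
      split_ifs with hx
      · rw [abs_of_nonneg hx]; ring
      · rw [abs_of_neg (not_le.mp hx)]; ring

lemma normFOn_nonneg_aux {V : Type*} [Fintype V] [DecidableEq V]
    (h : Finset V) (F : Finset V → ℝ) (x : V → ℝ) (hF : ∀ S ⊆ h, 0 ≤ F S) :
    0 ≤ normFOn h F x :=
  le_csSup (norm_bdd h F x) ⟨fun _ => 0, ⟨fun _ _ => rfl, fun S hS => by simpa using hF S hS⟩,
    by simp⟩

lemma holder {V : Type*} [Fintype V] [DecidableEq V]
    (h : Finset V) (F : Finset V → ℝ) (x z : V → ℝ)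
    (hmono : ∀ A B : Finset V, A ⊆ B → B ⊆ h → F A ≤ F B) (hF0 : F ∅ = 0)
    (hFi : ∀ i ∈ h, 0 < F {i})
    (hz : ∀ i, 0 ≤ z i) (hz0 : ∀ i, i ∉ h → z i = 0) :
    ∑ i, z i * |x i| ≤ dualNormFOn h F z * normFOn h F x := by
  have hF : ∀ S ⊆ h, 0 ≤ F S := fun S hS => hF0 ▸ hmono ∅ S (Finset.empty_subset _) hS
  have hne : {l : ℝ | 0 ≤ l ∧ ∀ S ⊆ h, (∑ i ∈ S, |z i|) ≤ l * F S}.Nonempty := by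
    have hnn : ∀ i ∈ h, 0 ≤ |z i| / F {i} := fun i hi => div_nonneg (abs_nonneg _) (hFi i hi).le
    refine ⟨∑ i ∈ h, |z i| / F {i}, Finset.sum_nonneg hnn, fun S hS => ?_⟩
    calc ∑ i ∈ S, |z i| ≤ ∑ i ∈ S, |z i| / F {i} * F S := by
          refine Finset.sum_le_sum fun i hi => ?_
          have h1 := hFi i (hS hi)
          have h2 := hmono {i} S (by simpa using hi) hS
          calc |z i| = |z i| / F {i} * F {i} := by field_simp
            _ ≤ _ := mul_le_mul_of_nonneg_left h2 (hnn i (hS hi))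
      _ = (∑ i ∈ S, |z i| / F {i}) * F S := by rw [Finset.sum_mul]
      _ ≤ _ := mul_le_mul_of_nonneg_right
          (Finset.sum_le_sum_of_subset_of_nonneg hS fun i hi _ => hnn i hi) (hF S hS)
  rcases (normFOn_nonneg_aux h F x hF).eq_or_lt with hN | hN
  · obtain ⟨l, hl, hS⟩ := hne
    have := holder_aux h F x z hF hz hz0 l hl hS
    rw [← hN] at this ⊢
    simpa using this
  · rw [← div_le_iff₀ hN]
    refine le_csInf hne fun l hl => ?_
    rw [div_le_iff₀ hN]
    exact holder_aux h F x z hF hz hz0 l hl.1 hl.2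

lemma demand_abs {V : Type*} [Fintype V] [DecidableEq V] (d x : V → ℝ) (a b : V) (w : ℝ)
    (hw : 0 ≤ w) (hd0 : ∑ i, d i = 0)
    (hd : ∀ i, |d i| = w * ((if a = i then (1 : ℝ) else 0) + (if b = i then 1 else 0))) :
    w * |x a - x b| ≤ |∑ i, d i * x i| := by
  by_cases hab : a = b
  · subst hab; simp
  have hz : ∀ i, i ≠ a → i ≠ b → d i = 0 := by
    intro i h1 h2
    have := hd i
    rw [if_neg (Ne.symm h1), if_neg (Ne.symm h2)] at this
    simpa using this
  have key : ∀ g : V → ℝ, ∑ i, d i * g i = d a * g a + d b * g b := by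
    intro g
    rw [← Finset.sum_pair (f := fun i => d i * g i) hab]
    symm
    refine Finset.sum_subset (Finset.subset_univ _) fun i _ hi => ?_
    simp only [Finset.mem_insert, Finset.mem_singleton, not_or] at hi
    rw [hz i hi.1 hi.2, zero_mul]
  have h1 := key (fun _ => 1)
  simp only [mul_one] at h1
  rw [hd0] at h1
  have hb : d b = - d a := by linarith
  have ha := hd a
  rw [if_pos rfl, if_neg (Ne.symm hab)] at ha
  rw [key, hb, show d a * x a + -d a * x b = d a * (x a - x b) by ring, abs_mul, ha]
  simp

/-- If the weighted graph `H` (edges indexed by `EH`, with endpoints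
`a f, b f` and weights `wH f`) embeds as a flow with congestion `ρ` into the weighted
submodular hypergraph `G` (hyperedges indexed by `E`, vertex sets `hyper e`, weights
`wG e`, monotone submodular cut functions induced by `F e`), then for every `x : ℝ^V`,
`∑_{{i,j} ∈ E_H} wH_{ij} |x_i − x_j| ≤ ρ · ∑_{h ∈ E_G} wG_h · min_u ‖x_h − u·1‖_{F_h}`. -/
theorem flow_embedding_metric_lower_bound
    {V E EH : Type*} [Fintype V] [DecidableEq V] [Fintype E] [Fintype EH]
    (hyper : E → Finset V) (wG : E → ℝ) (μ : V → ℝ) (F : E → Finset V → ℝ)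
    (hwG : ∀ e, 0 < wG e) (hμ : ∀ i, 0 ≤ μ i)
    (hsub : ∀ e, ∀ A B : Finset V, A ⊆ hyper e → B ⊆ hyper e →
      F e (A ∪ B) + F e (A ∩ B) ≤ F e A + F e B)
    (hmono : ∀ e, ∀ A B : Finset V, A ⊆ B → B ⊆ hyper e → F e A ≤ F e B)
    (hF0 : ∀ e, F e ∅ = 0)
    (hFi : ∀ e, ∀ i ∈ hyper e, 0 < F e {i})
    (a b : EH → V) (wH : EH → ℝ) (hwH : ∀ f, 0 ≤ wH f)
    (ρ : ℝ)
    -- the flows `Y f` witnessing the embedding `H ≼_ρ G`: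
    (Y : EH → E → V → ℝ)
    (hsupp : ∀ f e i, i ∉ hyper e → Y f e i = 0)
    (hcons : ∀ f e, (∑ i, Y f e i) = 0)
    (hdem : ∀ f i, |∑ e, Y f e i| =
      wH f * ((if a f = i then (1 : ℝ) else 0) + (if b f = i then 1 else 0)))
    (hcong : ∀ e, dualNormFOn (hyper e) (F e) (fun i => ∑ f, |Y f e i|) ≤ ρ * wG e) :
    ∀ x : V → ℝ,
      (∑ f, wH f * |x (a f) - x (b f)|) ≤
        ρ * ∑ e, wG e * ⨅ u : ℝ, normFOn (hyper e) (F e) (fun i => x i - u) := by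
  intro x
  have hA : ∀ e, ∑ f, |∑ i, Y f e i * x i| ≤
      ρ * (wG e * ⨅ u : ℝ, normFOn (hyper e) (F e) (fun i => x i - u)) := by
    intro e
    have hnn : 0 ≤ ρ * wG e := (Real.sInf_nonneg fun l hl => hl.1).trans (hcong e)
    rw [← mul_assoc, Real.mul_iInf_of_nonneg hnn]
    refine le_ciInf fun u => ?_
    have hF : ∀ S ⊆ hyper e, 0 ≤ F e S :=
      fun S hS => hF0 e ▸ hmono e ∅ S (Finset.empty_subset _) hS
    calc ∑ f, |∑ i, Y f e i * x i| ≤ ∑ f, ∑ i, |Y f e i| * |x i - u| := by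
          refine Finset.sum_le_sum fun f _ => ?_
          have : ∑ i, Y f e i * x i = ∑ i, Y f e i * (x i - u) := by
            simp only [mul_sub, Finset.sum_sub_distrib]
            rw [← Finset.sum_mul, hcons]; simp
          rw [this]
          refine (Finset.abs_sum_le_sum_abs _ _).trans (le_of_eq ?_)
          simp only [abs_mul]
      _ = ∑ i, (∑ f, |Y f e i|) * |x i - u| := by
          rw [Finset.sum_comm]
          simp only [Finset.sum_mul]
      _ ≤ _ := holder (hyper e) (F e) (fun i => x i - u) (fun i => ∑ f, |Y f e i|)
          (hmono e) (hF0 e) (hFi e) (fun i => Finset.sum_nonneg fun f _ => abs_nonneg _)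
          (fun i hi => Finset.sum_eq_zero fun f _ => by rw [hsupp f e i hi, abs_zero])
      _ ≤ _ := mul_le_mul_of_nonneg_right (hcong e) (normFOn_nonneg_aux _ _ _ hF)
  calc ∑ f, wH f * |x (a f) - x (b f)| ≤ ∑ f, ∑ e, |∑ i, Y f e i * x i| := by
        refine Finset.sum_le_sum fun f _ => ?_
        refine (demand_abs (fun i => ∑ e, Y f e i) x (a f) (b f) (wH f) (hwH f) ?_
          (hdem f)).trans ?_
        · rw [Finset.sum_comm]
          exact Finset.sum_eq_zero fun e _ => hcons f e
        · simp only [Finset.sum_mul]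
          rw [Finset.sum_comm]
          exact Finset.abs_sum_le_sum_abs _ _
    _ = ∑ e, ∑ f, |∑ i, Y f e i * x i| := Finset.sum_comm
    _ ≤ ∑ e, ρ * (wG e * ⨅ u : ℝ, normFOn (hyper e) (F e) (fun i => x i - u)) :=
        Finset.sum_le_sum fun e _ => hA e
    _ = _ := by rw [Finset.mul_sum]
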